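/- For every natural number N, there exist a connected finite simple graph G and an edge e ∈ E(G) such that the graph G − e obtained by deleting e is connected and bdim(G) ≥ bdim(G − e) + N. That is, the value bdim(G) − bdim(G − e) can be arbitrarily large. -/

import Mathlib

open SimpleGraph

/-- `f` is a resolving broadcast of `G`: for any two distinct vertices `x, y` there is a
vertex `z` with `f z > 0` such that `min (d(x,z)) (f z + 1) ≠ min (d(y,z)) (f z + 1)`,
where distances are extended naturals (`⊤` for vertices in different components). -/
def IsResolvingBroadcast {V : Type*} (G : SimpleGraph V) (f : V → ℕ) : Prop :=
  ∀ x y : V, x ≠ y → ∃ z : V, 0 < f z ∧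
    min (G.edist x z) ((f z : ℕ∞) + 1) ≠ min (G.edist y z) ((f z : ℕ∞) + 1)

/-- The broadcast dimension of `G`: the minimum of `∑ v, f v` over all
resolving broadcasts `f` of `G`. -/
noncomputable def bdim {V : Type*} [Fintype V] (G : SimpleGraph V) : ℕ :=
  sInf {n : ℕ | ∃ f : V → ℕ, IsResolvingBroadcast G f ∧ ∑ v, f v = n}

lemma edist_map_le {V W : Type*} {G : SimpleGraph V} {H : SimpleGraph W} (φ : G →g H) (x y : V) :
    H.edist (φ x) (φ y) ≤ G.edist x y := by
  refine le_iInf fun p => ?_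
  simpa using SimpleGraph.edist_le (p.map φ)

lemma le_edist_add_of_adj {V : Type*} {G : SimpleGraph V} (h : V → ℕ)
    (hG : ∀ x y, G.Adj x y → h x ≤ h y + 1) (x y : V) : (h x : ℕ∞) ≤ G.edist x y + h y := by
  suffices key : ∀ {x y} (p : G.Walk x y), h x ≤ p.length + h y by
    rw [SimpleGraph.edist, ENat.iInf_add]
    exact le_iInf fun p => mod_cast key p
  intro x y p
  induction p with
  | nil => simp
  | cons hadj p ih =>
    have := hG _ _ hadj
    simp only [SimpleGraph.Walk.length_cons]
    omega

/-- A vertex `s` with positive broadcast separates itself from every other vertex. -/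
lemma min_edist_self_ne {V : Type*} (G : SimpleGraph V) {s y : V} (hsy : s ≠ y) (r : ℕ) :
    min (G.edist s s) ((r : ℕ∞) + 1) ≠ min (G.edist y s) ((r : ℕ∞) + 1) := by
  rw [SimpleGraph.edist_self, zero_min]
  intro h
  rcases min_eq_iff.mp h.symm with h | h
  · exact hsy (SimpleGraph.edist_eq_zero_iff.mp h.1).symm
  · simp at h

lemma min_edist_ne_of_adj_of_not_adj {V : Type*} {G : SimpleGraph V} {x y s : V} {r : ℕ}
    (hr : 0 < r) (hx : G.Adj x s) (hy : ¬ G.Adj y s) :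
    min (G.edist x s) ((r : ℕ∞) + 1) ≠ min (G.edist y s) ((r : ℕ∞) + 1) := by
  have h1 : (1 : ℕ∞) < (r : ℕ∞) + 1 := by exact_mod_cast Nat.succ_lt_succ hr
  rw [SimpleGraph.edist_eq_one_iff_adj.mpr hx, min_eq_left h1.le]
  intro h
  rcases min_eq_iff.mp h.symm with h | h
  · exact hy (SimpleGraph.edist_eq_one_iff_adj.mp h.1)
  · exact h1.ne' h.1

lemma isResolvingBroadcast_one {V : Type*} (G : SimpleGraph V) :
    IsResolvingBroadcast G fun _ => 1 :=
  fun x _ hxy => ⟨x, one_pos, min_edist_self_ne G hxy 1⟩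

lemma bdim_le {V : Type*} [Fintype V] {G : SimpleGraph V} {f : V → ℕ}
    (hf : IsResolvingBroadcast G f) : bdim G ≤ ∑ v, f v :=
  Nat.sInf_le ⟨f, hf, rfl⟩

lemma le_bdim {V : Type*} [Fintype V] {G : SimpleGraph V} {n : ℕ}
    (h : ∀ f, IsResolvingBroadcast G f → n ≤ ∑ v, f v) : n ≤ bdim G := by
  refine le_csInf ⟨_, _, isResolvingBroadcast_one G, rfl⟩ ?_
  rintro _ ⟨f, hf, rfl⟩
  exact h f hf

namespace ShortcutGraph

/-- Vertices of the shortcut graph: two special vertices `hub` and `far`, the ends of the shortcut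
edge, `k` code vertices, and a triple `p i, a i, b i` for every set `i` of code vertices. -/
inductive Vertex (k : ℕ)
  | hub
  | far
  | code (t : Fin k)
  | p (i : Finset (Fin k))
  | a (i : Finset (Fin k))
  | b (i : Finset (Fin k))

open Vertex

variable {k : ℕ}

/-- The vertices as an iterated sum of index types. -/
def sumEquiv (k : ℕ) : Unit ⊕ Unit ⊕ Fin k ⊕ Finset (Fin k) ⊕ Finset (Fin k) ⊕ Finset (Fin k) ≃
    Vertex k where
  toFun
    | .inl _ => hub
    | .inr (.inl _) => far
    | .inr (.inr (.inl t)) => code t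
    | .inr (.inr (.inr (.inl i))) => p i
    | .inr (.inr (.inr (.inr (.inl i)))) => a i
    | .inr (.inr (.inr (.inr (.inr i)))) => b i
  invFun
    | hub => .inl ()
    | far => .inr (.inl ())
    | code t => .inr (.inr (.inl t))
    | p i => .inr (.inr (.inr (.inl i)))
    | a i => .inr (.inr (.inr (.inr (.inl i))))
    | b i => .inr (.inr (.inr (.inr (.inr i))))
  left_inv := by rintro (_ | _ | _ | _ | _ | _) <;> rfl
  right_inv := by rintro (_ | _ | _ | _ | _ | _) <;> rfl

instance : Fintype (Vertex k) := Fintype.ofEquiv _ (sumEquiv k)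

lemma sum_vertex (f : Vertex k → ℕ) :
    ∑ x, f x = f hub + f far + ∑ t, f (code t) + ∑ i, (f (p i) + f (a i) + f (b i)) := by
  rw [← (sumEquiv k).sum_comp]
  simp [Fintype.sum_sum_type, Finset.sum_add_distrib, sumEquiv]
  ring

/-- The edges other than the shortcut edge, each in one direction. -/
inductive Arc : Vertex k → Vertex k → Prop
  | hub_p (i) : Arc hub (p i)
  | p_a (i) : Arc (p i) (a i)
  | far_a (i) : Arc far (a i)
  | far_b (i) : Arc far (b i)
  | far_code (t) : Arc far (code t)
  | code_p {t i} (h : t ∈ i) : Arc (code t) (p i)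
  | code_a {t i} (h : t ∈ i) : Arc (code t) (a i)
  | code_b {t i} (h : t ∈ i) : Arc (code t) (b i)

/-- The graph without the shortcut edge. -/
def base (k : ℕ) : SimpleGraph (Vertex k) where
  Adj x y := Arc x y ∨ Arc y x
  symm := ⟨fun _ _ h => h.symm⟩
  loopless := ⟨fun x h => by rcases h with h | h <;> cases h⟩

/-- The graph with the shortcut edge from `hub` to `far`. -/
def shortcut (k : ℕ) : SimpleGraph (Vertex k) := base k ⊔ SimpleGraph.edge hub far

lemma not_base_adj_hub_far : ¬ (base k).Adj hub far := by
  rintro (h | h) <;> cases h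

lemma shortcut_adj_hub_far : (shortcut k).Adj hub far := by
  simp [shortcut, SimpleGraph.edge_adj]

lemma shortcut_deleteEdges : (shortcut k).deleteEdges {s(hub, far)} = base k := by
  ext x y
  have h : (base k).Adj x y → s(x, y) ≠ s(hub, far) := by
    intro h he
    rw [← SimpleGraph.mem_edgeSet, he] at h
    exact not_base_adj_hub_far h
  simp only [shortcut, SimpleGraph.deleteEdges_adj, SimpleGraph.sup_adj, SimpleGraph.edge_adj,
    Set.mem_singleton_iff]
  grind

lemma base_connected : (base k).Connected := by
  have adj_reachable {x y} (h : Arc x y ∨ Arc y x) : (base k).Reachable x y :=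
    SimpleGraph.Adj.reachable h
  have ha (i) : (base k).Reachable (a i) far := adj_reachable (.inr (.far_a i))
  have hp (i) : (base k).Reachable (p i) far :=
    (adj_reachable (.inl (.p_a i))).trans (ha i)
  have key (x) : (base k).Reachable x far := by
    cases x with
    | hub => exact (adj_reachable (.inl (.hub_p ∅))).trans (hp ∅)
    | far => rfl
    | code t => exact adj_reachable (.inr (.far_code t))
    | p i => exact hp i
    | a i => exact ha i
    | b i => exact adj_reachable (.inr (.far_b i))
  have : Nonempty (Vertex k) := ⟨far⟩
  exact ⟨fun x y => (key x).trans (key y).symm⟩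

/-- A broadcast of cost `k + 3` that resolves the graph without the shortcut edge. -/
def broadcast : Vertex k → ℕ
  | hub => 2
  | far => 1
  | code _ => 1
  | _ => 0

lemma sum_broadcast : ∑ x : Vertex k, broadcast x = k + 3 := by
  rw [sum_vertex]
  simp [broadcast]
  ring

/-- A lower bound for the distance to `hub` in the graph without the shortcut edge. -/
def height : Vertex k → ℕ
  | hub => 0
  | p _ => 1
  | a _ => 2
  | code _ => 2
  | b _ => 3
  | far => 3

lemma three_le_edist_b_hub (i : Finset (Fin k)) : 3 ≤ (base k).edist (b i) hub := by
  have h := le_edist_add_of_adj (G := base k) height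
    (by rintro x y (h | h) <;> cases h <;> simp [height]) (b i) hub
  simpa [height] using h

lemma edist_a_hub_le (i : Finset (Fin k)) : (base k).edist (a i) hub ≤ 2 := by
  have h₁ : (base k).Adj (a i) (p i) := .inr (.p_a i)
  have h₂ : (base k).Adj (p i) hub := .inr (.hub_p i)
  simpa using SimpleGraph.edist_le (h₁.toWalk.append h₂.toWalk)

lemma min_edist_a_hub_ne (i j : Finset (Fin k)) :
    min ((base k).edist (a i) hub) ((2 : ℕ) + 1) ≠ min ((base k).edist (b j) hub) ((2 : ℕ) + 1) := by
  have h : ((2 : ℕ) : ℕ∞) + 1 = 3 := rfl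
  rw [h, min_eq_right (three_le_edist_b_hub j)]
  exact ((min_le_left _ _).trans_lt ((edist_a_hub_le i).trans_lt (by norm_num))).ne

/-- Vertices whose adjacency to the code vertices spells out distinct sets are separated. -/
lemma exists_code_separates {x y : Vertex k} {i j : Finset (Fin k)} (hij : i ≠ j)
    (hx : ∀ t, (base k).Adj x (code t) ↔ t ∈ i) (hy : ∀ t, (base k).Adj y (code t) ↔ t ∈ j) :
    ∃ z : Vertex k, 0 < broadcast z ∧
      min ((base k).edist x z) ((broadcast z : ℕ∞) + 1) ≠
        min ((base k).edist y z) ((broadcast z : ℕ∞) + 1) := by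
  obtain ⟨t, ht⟩ : ∃ t, ¬ (t ∈ i ↔ t ∈ j) := by
    by_contra! h
    exact hij (Finset.ext h)
  refine ⟨code t, one_pos, ?_⟩
  rw [← hx, ← hy] at ht
  by_cases h : (base k).Adj x (code t)
  · exact min_edist_ne_of_adj_of_not_adj one_pos h (by tauto)
  · exact (min_edist_ne_of_adj_of_not_adj one_pos (by grind) h).symm

lemma adj_p_code (i : Finset (Fin k)) (t : Fin k) : (base k).Adj (p i) (code t) ↔ t ∈ i :=
  ⟨fun h => by rcases h with h | h <;> cases h; assumption, fun h => .inr (.code_p h)⟩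

lemma adj_a_code (i : Finset (Fin k)) (t : Fin k) : (base k).Adj (a i) (code t) ↔ t ∈ i :=
  ⟨fun h => by rcases h with h | h <;> cases h; assumption, fun h => .inr (.code_a h)⟩

lemma adj_b_code (i : Finset (Fin k)) (t : Fin k) : (base k).Adj (b i) (code t) ↔ t ∈ i :=
  ⟨fun h => by rcases h with h | h <;> cases h; assumption, fun h => .inr (.code_b h)⟩

lemma isResolvingBroadcast_broadcast : IsResolvingBroadcast (base k) broadcast := by
  intro x y hxy
  by_cases hx : 0 < broadcast x
  · exact ⟨x, hx, min_edist_self_ne _ hxy _⟩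
  by_cases hy : 0 < broadcast y
  · exact ⟨y, hy, (min_edist_self_ne _ hxy.symm _).symm⟩
  have adj_hub (i) : (base k).Adj (p i) hub := .inr (.hub_p i)
  have not_adj_a (i) : ¬ (base k).Adj (a i) hub := by rintro (h | h) <;> cases h
  have not_adj_b (i) : ¬ (base k).Adj (b i) hub := by rintro (h | h) <;> cases h
  rcases x with _ | _ | _ | i | i | i <;> rcases y with _ | _ | _ | j | j | j
  any_goals exact absurd two_pos hx
  any_goals exact absurd one_pos hx
  any_goals exact absurd two_pos hy
  any_goals exact absurd one_pos hy
  · exact exists_code_separates (by simpa using hxy) (adj_p_code i) (adj_p_code j)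
  · exact ⟨hub, two_pos, min_edist_ne_of_adj_of_not_adj two_pos (adj_hub i) (not_adj_a j)⟩
  · exact ⟨hub, two_pos, min_edist_ne_of_adj_of_not_adj two_pos (adj_hub i) (not_adj_b j)⟩
  · exact ⟨hub, two_pos, (min_edist_ne_of_adj_of_not_adj two_pos (adj_hub j) (not_adj_a i)).symm⟩
  · exact exists_code_separates (by simpa using hxy) (adj_a_code i) (adj_a_code j)
  · exact ⟨hub, two_pos, min_edist_a_hub_ne i j⟩
  · exact ⟨hub, two_pos, (min_edist_ne_of_adj_of_not_adj two_pos (adj_hub j) (not_adj_b i)).symm⟩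
  · exact ⟨hub, two_pos, (min_edist_a_hub_ne j i).symm⟩
  · exact exists_code_separates (by simpa using hxy) (adj_b_code i) (adj_b_code j)

lemma bdim_base_le : bdim (base k) ≤ k + 3 :=
  (bdim_le isResolvingBroadcast_broadcast).trans_eq sum_broadcast

/-- A map sending arcs and the shortcut edge to edges is a homomorphism. -/
def shortcutHom (φ : Vertex k → Vertex k) (hub_far : (shortcut k).Adj (φ hub) (φ far))
    (arc : ∀ x y, Arc x y → (shortcut k).Adj (φ x) (φ y)) : shortcut k →g shortcut k where
  toFun := φ
  map_rel' {x y} h := by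
    rcases h with (h | h) | h
    · exact arc _ _ h
    · exact (arc _ _ h).symm
    · rw [SimpleGraph.edge_adj] at h
      rcases h.1 with ⟨rfl, rfl⟩ | ⟨rfl, rfl⟩
      · exact hub_far
      · exact hub_far.symm

lemma Arc.shortcut_adj {x y : Vertex k} (h : Arc x y) : (shortcut k).Adj x y := .inl (.inl h)

/-- The folding of `b i` onto `a i`. -/
def foldB (i : Finset (Fin k)) : Vertex k → Vertex k
  | b j => if j = i then a i else b j
  | x => x

/-- The folding of `a i` onto `b i`, moving `p i` to `far`. -/
def foldA (i : Finset (Fin k)) : Vertex k → Vertex k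
  | p j => if j = i then far else p j
  | a j => if j = i then b i else a j
  | x => x

lemma edist_a_le_edist_b {i : Finset (Fin k)} {w : Vertex k} (hb : w ≠ b i) :
    (shortcut k).edist (a i) w ≤ (shortcut k).edist (b i) w := by
  have h := edist_map_le (shortcutHom (foldB i) shortcut_adj_hub_far (by
    intro x y h
    cases h with
    | far_b j =>
      by_cases hj : j = i
      · simpa [foldB, hj] using (Arc.far_a i).shortcut_adj
      · simpa [foldB, hj] using (Arc.far_b j).shortcut_adj
    | @code_b t j ht =>
      by_cases hj : j = i
      · subst hj
        simpa [foldB] using (Arc.code_a ht).shortcut_adj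
      · simpa [foldB, hj] using (Arc.code_b ht).shortcut_adj
    | _ => exact Arc.shortcut_adj (by constructor <;> assumption))) (b i) w
  have hw : foldB i w = w := by
    cases w <;> grind [foldB]
  change (shortcut k).edist (foldB i (b i)) (foldB i w) ≤ _ at h
  rw [hw] at h
  simpa [foldB] using h

lemma edist_b_le_edist_a {i : Finset (Fin k)} {w : Vertex k} (hp : w ≠ p i) (ha : w ≠ a i) :
    (shortcut k).edist (b i) w ≤ (shortcut k).edist (a i) w := by
  have h := edist_map_le (shortcutHom (foldA i) shortcut_adj_hub_far (by
    intro x y h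
    have h' := h.shortcut_adj
    cases h with
    | far_b | far_code | code_b => exact h'
    | hub_p j =>
      by_cases hj : j = i
      · simpa [foldA, hj] using shortcut_adj_hub_far
      · simpa [foldA, hj] using h'
    | p_a j =>
      by_cases hj : j = i
      · simpa [foldA, hj] using (Arc.far_b i).shortcut_adj
      · simpa [foldA, hj] using h'
    | far_a j =>
      by_cases hj : j = i
      · simpa [foldA, hj] using (Arc.far_b i).shortcut_adj
      · simpa [foldA, hj] using h'
    | @code_p t j ht =>
      by_cases hj : j = i
      · simpa [foldA, hj] using (Arc.far_code t).shortcut_adj.symm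
      · simpa [foldA, hj] using h'
    | @code_a t j ht =>
      by_cases hj : j = i
      · subst hj
        simpa [foldA] using (Arc.code_b ht).shortcut_adj
      · simpa [foldA, hj] using h')) (a i) w
  have hw : foldA i w = w := by
    cases w <;> grind [foldA]
  change (shortcut k).edist (foldA i (a i)) (foldA i w) ≤ _ at h
  rw [hw] at h
  simpa [foldA] using h

lemma one_le_of_isResolvingBroadcast {f : Vertex k → ℕ} (hf : IsResolvingBroadcast (shortcut k) f)
    (i : Finset (Fin k)) : 1 ≤ f (p i) + f (a i) + f (b i) := by
  obtain ⟨z, hz, hne⟩ := hf (a i) (b i) (by simp)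
  by_cases hp : z = p i
  · subst hp; omega
  by_cases ha : z = a i
  · subst ha; omega
  by_cases hb : z = b i
  · subst hb; omega
  rw [(edist_a_le_edist_b hb).antisymm (edist_b_le_edist_a hp ha)] at hne
  exact absurd rfl hne

lemma two_pow_le_bdim_shortcut : 2 ^ k ≤ bdim (shortcut k) := by
  refine le_bdim fun f hf => ?_
  calc 2 ^ k = ∑ _i : Finset (Fin k), 1 := by simp
    _ ≤ ∑ i, (f (p i) + f (a i) + f (b i)) :=
      Finset.sum_le_sum fun i _ => one_le_of_isResolvingBroadcast hf i
    _ ≤ ∑ x, f x := by rw [sum_vertex]; omega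

end ShortcutGraph

/-- The value `bdim G - bdim (G - e)` can be arbitrarily large: for every `N` there are
a connected graph `G` and an edge `e = uv` with `G - e` connected and
`bdim G ≥ bdim (G - e) + N`. -/
theorem bdim_sub_bdim_deleteEdge_unbounded (N : ℕ) :
    ∃ (V : Type) (inst : Fintype V) (G : SimpleGraph V) (u v : V),
      G.Adj u v ∧ G.Connected ∧ (G.deleteEdges {s(u, v)}).Connected ∧
      @bdim V inst (G.deleteEdges {s(u, v)}) + N ≤ @bdim V inst G := by
  have hconn := ShortcutGraph.base_connected (k := N + 3)
  refine ⟨ShortcutGraph.Vertex (N + 3), inferInstance, ShortcutGraph.shortcut (N + 3), .hub, .far,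
    ShortcutGraph.shortcut_adj_hub_far, hconn.mono le_sup_left, ?_⟩
  rw [ShortcutGraph.shortcut_deleteEdges]
  refine ⟨hconn, ?_⟩
  have h₁ := ShortcutGraph.bdim_base_le (k := N + 3)
  have h₂ := ShortcutGraph.two_pow_le_bdim_shortcut (k := N + 3)
  have h₃ : N + 1 ≤ 2 ^ N := Nat.lt_two_pow_self
  rw [pow_add] at h₂
  omega
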